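/- Let k, m ≥ 2. Then GKdim(T_km^{(0)}) = GKdim(C_km^{(0)}) = (k²−1)(m−1); that is, for A equal to T_km^{(0)} or C_km^{(0)} one has limsup_{n→∞} log_n dim_K(A ∩ M_k(Ω_{≤n})) = (k²−1)(m−1), where Ω_{≤n} ⊆ Ω is the subspace of polynomials of total degree at most n. -/

import Mathlib

open scoped BigOperators
noncomputable section

/-- `Ω = K[y_pq^(i)]`, matrices over the polynomial ring in `k²m` variables. -/
abbrev Mat (K : Type) [Field K] (k m : ℕ) :=
  Matrix (Fin k) (Fin k) (MvPolynomial (Fin m × Fin k × Fin k) K)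

/-- The generic `k × k` matrices `y_i = (y_pq^(i))`. -/
def genY (K : Type) [Field K] (k m : ℕ) (i : Fin m) : Mat K k m :=
  Matrix.of fun p q => MvPolynomial.X (i, p, q)

/-- The scalar matrix `f · I` for `f ∈ Ω`. -/
def scalarOf (K : Type) [Field K] (k m : ℕ)
    (f : MvPolynomial (Fin m × Fin k × Fin k) K) : Mat K k m :=
  algebraMap _ _ f

/-- `R_km`: the generic matrix algebra, generated by `y_1, …, y_m`. -/
def Rkm (K : Type) [Field K] (k m : ℕ) : Subalgebra K (Mat K k m) :=
  Algebra.adjoin K (Set.range (genY K k m))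

/-- `C_km`: the pure trace algebra, generated by the `tr(y_{i_1} ⋯ y_{i_l}) · I`, `l ≥ 1`. -/
def Ckm (K : Type) [Field K] (k m : ℕ) : Subalgebra K (Mat K k m) :=
  Algebra.adjoin K
    {x | ∃ (l : ℕ) (w : Fin (l + 1) → Fin m),
      x = scalarOf K k m (Matrix.trace ((List.ofFn fun j => genY K k m (w j)).prod))}

/-- `T_km`: the mixed trace algebra, generated by `R_km ∪ C_km`. -/
def Tkm (K : Type) [Field K] (k m : ℕ) : Subalgebra K (Mat K k m) :=
  Rkm K k m ⊔ Ckm K k m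

/-- The generic traceless matrices `z_i = y_i - (1/k)·tr(y_i)·I`. -/
def genZ (K : Type) [Field K] (k m : ℕ) (i : Fin m) : Mat K k m :=
  genY K k m i - (k : K)⁻¹ • scalarOf K k m (Matrix.trace (genY K k m i))

/-- `W_km`: the algebra generated by the generic traceless matrices `z_1, …, z_m`. -/
def Wkm (K : Type) [Field K] (k m : ℕ) : Subalgebra K (Mat K k m) :=
  Algebra.adjoin K (Set.range (genZ K k m))

/-- `C_km⁰`: the algebra generated by the `tr(z_{i_1} ⋯ z_{i_l}) · I`, `l ≥ 1`. -/
def Ckm0 (K : Type) [Field K] (k m : ℕ) : Subalgebra K (Mat K k m) :=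
  Algebra.adjoin K
    {x | ∃ (l : ℕ) (w : Fin (l + 1) → Fin m),
      x = scalarOf K k m (Matrix.trace ((List.ofFn fun j => genZ K k m (w j)).prod))}

/-- `T_km⁰`: the algebra generated by `W_km ∪ C_km⁰`. -/
def Tkm0 (K : Type) [Field K] (k m : ℕ) : Subalgebra K (Mat K k m) :=
  Wkm K k m ⊔ Ckm0 K k m

/-- The subspace of matrices all of whose entries have total degree at most `n`,
i.e. `M_k(Ω_{≤n})`. -/
def degLE (K : Type) [Field K] (k m n : ℕ) : Submodule K (Mat K k m) where
  carrier := {a | ∀ p q, (a p q).totalDegree ≤ n}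
  add_mem' := by
    intro a b ha hb p q
    calc ((a + b) p q).totalDegree = (a p q + b p q).totalDegree := by simp [Matrix.add_apply]
    _ ≤ max (a p q).totalDegree (b p q).totalDegree := MvPolynomial.totalDegree_add _ _
    _ ≤ n := max_le (ha p q) (hb p q)
  zero_mem' := by intro p q; simp
  smul_mem' := by
    intro c a ha p q
    calc ((c • a) p q).totalDegree = (c • a p q).totalDegree := by simp [Matrix.smul_apply]
    _ ≤ (a p q).totalDegree := MvPolynomial.totalDegree_smul_le _ _
    _ ≤ n := ha p q

/-- The growth function `n ↦ dim_K (A ∩ M_k(Ω_{≤n}))` of a subalgebra of `M_k(Ω)`. -/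
def growth (K : Type) [Field K] (k m : ℕ) (A : Subalgebra K (Mat K k m)) (n : ℕ) : ℕ :=
  Module.finrank K ↥(Subalgebra.toSubmodule A ⊓ degLE K k m n)

section Equivariance

variable {K : Type} [Field K] {k m : ℕ} {R : Type} [CommRing R] [Algebra K R]

/-- Evaluation of a matrix over `Ω` at a tuple of matrices. -/
def evalAt (a : Fin m → Matrix (Fin k) (Fin k) R) :
    Mat K k m →ₐ[K] Matrix (Fin k) (Fin k) R :=
  (MvPolynomial.aeval fun v : Fin m × Fin k × Fin k => a v.1 v.2.1 v.2.2).mapMatrix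

theorem evalAt_apply (a : Fin m → Matrix (Fin k) (Fin k) R) (P : Mat K k m) (p q : Fin k) :
    evalAt a P p q =
      MvPolynomial.aeval (fun v : Fin m × Fin k × Fin k => a v.1 v.2.1 v.2.2) (P p q) := rfl

theorem evalAt_genY (a : Fin m → Matrix (Fin k) (Fin k) R) (i : Fin m) :
    evalAt a (genY K k m i) = a i := by
  ext p q
  simp [evalAt_apply, genY]

theorem evalAt_scalarOf (a : Fin m → Matrix (Fin k) (Fin k) R)
    (f : MvPolynomial (Fin m × Fin k × Fin k) K) :
    evalAt a (scalarOf K k m f) = algebraMap R _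
      (MvPolynomial.aeval (fun v : Fin m × Fin k × Fin k => a v.1 v.2.1 v.2.2) f) := by
  ext p q
  rw [evalAt_apply, scalarOf, Matrix.algebraMap_matrix_apply, Matrix.algebraMap_matrix_apply]
  split_ifs
  · rfl
  · exact map_zero _

theorem aeval_trace (a : Fin m → Matrix (Fin k) (Fin k) R) (P : Mat K k m) :
    MvPolynomial.aeval (fun v : Fin m × Fin k × Fin k => a v.1 v.2.1 v.2.2) P.trace =
      (evalAt a P).trace := by
  simp [Matrix.trace, evalAt_apply]

/-- The traceless part of a matrix. -/
def tracelessPart (K : Type) [Field K] {k : ℕ} {R : Type} [CommRing R] [Algebra K R]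
    (a : Matrix (Fin k) (Fin k) R) : Matrix (Fin k) (Fin k) R :=
  a - (k : K)⁻¹ • algebraMap R _ a.trace

theorem evalAt_genZ (a : Fin m → Matrix (Fin k) (Fin k) R) (i : Fin m) :
    evalAt a (genZ K k m i) = tracelessPart K (a i) := by
  simp only [genZ, map_sub, map_smul, evalAt_scalarOf, aeval_trace, evalAt_genY, tracelessPart]

theorem evalAt_word (a : Fin m → Matrix (Fin k) (Fin k) R) {l : ℕ} (w : Fin l → Fin m) :
    evalAt a (List.ofFn fun j => genZ K k m (w j)).prod =
      (List.ofFn fun j => tracelessPart K (a (w j))).prod := by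
  simp [map_list_prod, List.map_ofFn, Function.comp_def, evalAt_genZ]

theorem tracelessPart_conj [CharZero K] (hk : k ≠ 0) (a : Matrix (Fin k) (Fin k) R) (c : R)
    (g : (Matrix (Fin k) (Fin k) R)ˣ) :
    tracelessPart K (g.1 * (a + algebraMap R _ c) * g⁻¹.1) =
      g.1 * tracelessPart K a * g⁻¹.1 := by
  have hk' : (k : K) ≠ 0 := by exact_mod_cast hk
  have h1 (r : R) : g.1 * algebraMap R (Matrix (Fin k) (Fin k) R) r * g⁻¹.1 =
      algebraMap R _ r := by
    rw [← Algebra.commutes, mul_assoc, Units.mul_inv, mul_one]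
  have h2 : (g.1 * (a + algebraMap R _ c) * g⁻¹.1).trace = a.trace + k * c := by
    rw [mul_assoc, Matrix.trace_mul_comm, mul_assoc, Units.inv_mul, mul_one, Matrix.trace_add,
      Matrix.algebraMap_eq_diagonal, Matrix.trace_diagonal]
    simp
  have h3 : (k : K)⁻¹ • algebraMap R (Matrix (Fin k) (Fin k) R) (k * c) = algebraMap R _ c := by
    have h : (k : R) * c = (k : K) • c := by rw [Algebra.smul_def, map_natCast]
    rw [h, Algebra.algebraMap_eq_smul_one, smul_assoc, smul_smul, inv_mul_cancel₀ hk', one_smul,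
      Algebra.algebraMap_eq_smul_one]
  rw [tracelessPart, h2, map_add, smul_add, h3, tracelessPart]
  simp only [mul_add, add_mul, mul_sub, sub_mul, h1, mul_smul_comm, smul_mul_assoc]
  abel

/-- Elements of `T_km⁰` are concomitants which do not see scalar summands. -/
theorem evalAt_conj_of_mem [CharZero K] (hk : k ≠ 0) {P : Mat K k m} (hP : P ∈ Tkm0 K k m)
    (g : (Matrix (Fin k) (Fin k) R)ˣ) (c : Fin m → R)
    (a b : Fin m → Matrix (Fin k) (Fin k) R)
    (h : ∀ i, b i = g.1 * (a i + algebraMap R _ (c i)) * g⁻¹.1) :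
    evalAt b P = g.1 * evalAt a P * g⁻¹.1 := by
  have hz (i : Fin m) : tracelessPart K (b i) = g.1 * tracelessPart K (a i) * g⁻¹.1 := by
    rw [h, tracelessPart_conj hk]
  have hw {l : ℕ} (w : Fin l → Fin m) : (List.ofFn fun j => tracelessPart K (b (w j))).prod =
      g.1 * (List.ofFn fun j => tracelessPart K (a (w j))).prod * g⁻¹.1 := by
    induction l with
    | zero => simp
    | succ l ih =>
      rw [List.ofFn_succ, List.ofFn_succ, List.prod_cons, List.prod_cons,
        ih fun j => w j.succ, hz]
      simp [mul_assoc]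
  rw [Tkm0, Wkm, Ckm0, ← Algebra.adjoin_union] at hP
  induction hP using Algebra.adjoin_induction with
  | mem x hx =>
    rcases hx with ⟨i, rfl⟩ | ⟨l, w, rfl⟩
    · rw [evalAt_genZ, evalAt_genZ, hz]
    · rw [evalAt_scalarOf, evalAt_scalarOf, aeval_trace, aeval_trace, evalAt_word, evalAt_word,
        ← Algebra.commutes, mul_assoc, Units.mul_inv, mul_one, hw, Matrix.trace_mul_comm,
        ← mul_assoc, Units.inv_mul, one_mul]
  | algebraMap r =>
    rw [AlgHom.commutes, AlgHom.commutes, ← Algebra.commutes, mul_assoc, Units.mul_inv, mul_one]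
  | add x y _ _ hx hy => simp [hx, hy, mul_add, add_mul]
  | mul x y _ _ hx hy => simp [hx, hy, mul_assoc]

end Equivariance

section Diagonalization

open Polynomial in
theorem Matrix.exists_mul_eq_mul_diagonal {L : Type} [Field L] [IsAlgClosed L] {k : ℕ}
    (A : Matrix (Fin k) (Fin k) L) (hA : A.charpoly.Separable) :
    ∃ (g : (Matrix (Fin k) (Fin k) L)ˣ) (d : Fin k → L), A * g.1 = g.1 * Matrix.diagonal d := by
  classical
  have hcard : Fintype.card (A.charpoly.rootSet L) = k := by
    rw [Polynomial.card_rootSet_eq_natDegree hA (IsAlgClosed.splits _),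
      Matrix.charpoly_natDegree_eq_dim, Fintype.card_fin]
  let e : Fin k ≃ A.charpoly.rootSet L := (Fintype.equivFinOfCardEq hcard).symm
  have hroot (j : Fin k) : Module.End.HasEigenvalue A.toLin' (e j : L) := by
    rw [Module.End.hasEigenvalue_iff_isRoot_charpoly, Matrix.charpoly_toLin']
    have := (Polynomial.mem_rootSet.1 (e j).2).2
    rwa [Polynomial.coe_aeval_eq_eval] at this
  choose v hv using fun j => (hroot j).exists_hasEigenvector
  have hli : LinearIndependent L v :=
    Module.End.eigenvectors_linearIndependent' A.toLin' (fun j => (e j : L))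
      (Subtype.val_injective.comp e.injective) v hv
  have hu : IsUnit (Matrix.of fun p q => v q p) :=
    Matrix.linearIndependent_cols_iff_isUnit.1 hli
  obtain ⟨g, hg⟩ := hu
  refine ⟨g, fun j => e j, ?_⟩
  ext p q
  have := congrFun (hv q).apply_eq_smul p
  rw [hg, Matrix.mul_diagonal]
  rw [Matrix.toLin'_apply] at this
  simpa [Matrix.mul_apply, Matrix.mulVec, dotProduct, mul_comm] using this

/-- Separability of a monic polynomial can be checked after a specialization. -/
theorem Polynomial.Monic.separable_map_of_specialization {R F L : Type} [CommRing R] [Field F]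
    [CharZero F] [Field L] [CharZero L] {f : Polynomial R} (hf : f.Monic)
    (φ : R →+* F) (ψ : R →+* L) (hψ : Function.Injective ψ) (h : (f.map φ).Separable) :
    (f.map ψ).Separable := by
  have key {S : Type} [Field S] [CharZero S] (χ : R →+* S) : (f.map χ).Separable ↔
      χ (resultant f f.derivative f.natDegree (f.natDegree - 1)) ≠ 0 := by
    rw [Separable, ← isUnit_resultant_iff_isCoprime (hf.map χ), isUnit_iff_ne_zero,
      natDegree_derivative, hf.natDegree_map, derivative_map, resultant_map_map]
  rw [key, map_ne_zero_iff ψ hψ]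
  rw [key] at h
  exact fun h0 => h (by rw [h0, map_zero])

variable {K : Type} [Field K] [CharZero K] {k m : ℕ}

theorem separable_charpoly_genY (i : Fin m) {L : Type} [Field L] [CharZero L]
    (ψ : MvPolynomial (Fin m × Fin k × Fin k) K →+* L) (hψ : Function.Injective ψ) :
    ((genY K k m i).map ψ).charpoly.Separable := by
  rw [Matrix.charpoly_map]
  refine (Matrix.charpoly_monic _).separable_map_of_specialization
    (MvPolynomial.eval fun v => if v.2.1 = v.2.2 then ((v.2.1 : ℕ) : K) else 0) ψ hψ ?_
  have h : (genY K k m i).map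
      (MvPolynomial.eval fun v => if v.2.1 = v.2.2 then ((v.2.1 : ℕ) : K) else 0) =
      Matrix.diagonal fun j : Fin k => ((j : ℕ) : K) := by
    ext p q
    simp [genY, Matrix.diagonal_apply]
  rw [← Matrix.charpoly_map, h, Matrix.charpoly_diagonal, Polynomial.separable_prod_X_sub_C_iff]
  exact fun a b hab => Fin.ext (Nat.cast_injective hab)

end Diagonalization

section Slice

variable {K : Type} [Field K] {k m : ℕ} {R S : Type} [CommRing R] [Algebra K R]
  [CommRing S] [Algebra K S]

theorem evalAt_map (φ : R →ₐ[K] S) (a : Fin m → Matrix (Fin k) (Fin k) R) (P : Mat K k m) :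
    evalAt (fun i => (a i).map φ) P = (evalAt a P).map φ := by
  ext p q
  simp only [evalAt_apply, Matrix.map_apply]
  rw [← AlgHom.comp_apply, MvPolynomial.comp_aeval]

/-- The coordinates which remain free on the slice: the matrix `y_{i₀}` is diagonal, the row `o`
of `y_{i₁}` is normalized, and all entries `(o, o)` vanish. -/
abbrev IsSliceVar (o : Fin k) (i₀ i₁ : Fin m) (v : Fin m × Fin k × Fin k) : Prop :=
  v.2 ≠ (o, o) ∧ (v.1 = i₀ → v.2.1 = v.2.2) ∧ (v.1 = i₁ → v.2.1 ≠ o)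

/-- The type of free coordinates on the slice. -/
abbrev SliceVar (o : Fin k) (i₀ i₁ : Fin m) : Type := {v // IsSliceVar o i₀ i₁ v}

/-- The generic point of the slice. -/
def slicePt (K : Type) [Field K] (o : Fin k) (i₀ i₁ : Fin m) (i : Fin m) :
    Matrix (Fin k) (Fin k) (MvPolynomial (SliceVar o i₀ i₁) K) :=
  Matrix.of fun p q =>
    if h : IsSliceVar o i₀ i₁ (i, p, q) then MvPolynomial.X ⟨(i, p, q), h⟩
    else if i = i₁ ∧ p = o ∧ q ≠ o then 1 else 0

variable {o : Fin k} {i₀ i₁ : Fin m}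

theorem evalAt_eq_zero_of_slice {P : Mat K k m}
    (hP : evalAt (slicePt K o i₀ i₁) P = 0) (s : Fin m → Matrix (Fin k) (Fin k) R)
    (h₀ : ∀ p q, p ≠ q → s i₀ p q = 0) (h₁ : ∀ q, q ≠ o → s i₁ o q = 1)
    (h₂ : ∀ i, s i o o = 0) : evalAt s P = 0 := by
  have hs : s = fun i => (slicePt K o i₀ i₁ i).map
      (MvPolynomial.aeval fun v : SliceVar o i₀ i₁ => s v.1.1 v.1.2.1 v.1.2.2) := by
    ext i p q
    simp only [Matrix.map_apply, slicePt, Matrix.of_apply]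
    split_ifs with h h'
    · simp
    · obtain ⟨rfl, rfl, hq⟩ := h'
      simp [h₁ q hq]
    · simp only [map_zero]
      by_cases hpq : p = o ∧ q = o
      · rw [hpq.1, hpq.2, h₂]
      · by_cases hi0 : i = i₀ ∧ p ≠ q
        · rw [hi0.1, h₀ p q hi0.2]
        · exfalso
          apply h
          refine ⟨by simpa using hpq, fun h => by_contra fun hh => hi0 ⟨h, hh⟩, fun hh hp => ?_⟩
          exact h' ⟨hh, hp, fun hq => hpq ⟨hp, hq⟩⟩
  rw [hs, evalAt_map, hP]
  ext p q
  simp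

variable [CharZero K] {L : Type} [Field L] [Algebra K L]

theorem evalAt_eq_zero_of_diagonal_of_ne_zero {P : Mat K k m}
    (hT : P ∈ Tkm0 K k m) (hP : evalAt (slicePt K o i₀ i₁) P = 0)
    (b : Fin m → Matrix (Fin k) (Fin k) L) (h₀ : ∀ p q, p ≠ q → b i₀ p q = 0)
    (h₁ : ∀ q, q ≠ o → b i₁ o q ≠ 0) : evalAt b P = 0 := by
  have hk : k ≠ 0 := o.pos.ne'
  let t : Fin k → L := fun q => if q = o then 1 else b i₁ o q
  have ht (q : Fin k) : t q ≠ 0 := by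
    by_cases hq : q = o
    · simp [t, hq]
    · simpa [t, hq] using h₁ q hq
  let g : (Matrix (Fin k) (Fin k) L)ˣ :=
    { val := Matrix.diagonal fun q => (t q)⁻¹
      inv := Matrix.diagonal t
      val_inv := by simp [ht]
      inv_val := by simp [ht] }
  let s : Fin m → Matrix (Fin k) (Fin k) L := fun i =>
    Matrix.diagonal t * (b i - algebraMap L _ (b i o o)) * Matrix.diagonal fun q => (t q)⁻¹
  have hs : evalAt s P = 0 := by
    refine evalAt_eq_zero_of_slice hP s ?_ ?_ ?_
    · intro p q hpq
      simp [s, Matrix.mul_diagonal, Matrix.diagonal_mul, Matrix.algebraMap_matrix_apply, hpq,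
        h₀ p q hpq]
    · intro q hq
      have := h₁ q hq
      simp [s, Matrix.mul_diagonal, Matrix.diagonal_mul, Matrix.algebraMap_matrix_apply, hq.symm,
        hq, t, this]
    · intro i
      simp [s, Matrix.mul_diagonal, Matrix.diagonal_mul, Matrix.algebraMap_matrix_apply]
  rw [evalAt_conj_of_mem hk hT g (fun i => b i o o) s b, hs]
  · simp
  · intro i
    have h : algebraMap L (Matrix (Fin k) (Fin k) L) (b i o o) =
        g⁻¹.1 * algebraMap L _ (b i o o) * g.1 := by
      rw [← Algebra.commutes, mul_assoc, Units.inv_mul, mul_one]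
    have hs : s i = g⁻¹.1 * (b i - algebraMap L _ (b i o o)) * g.1 := rfl
    rw [h, hs, ← add_mul, ← mul_add, sub_add_cancel, mul_assoc, mul_assoc, mul_assoc,
      Units.mul_inv, mul_one, ← mul_assoc, Units.mul_inv, one_mul]

theorem evalAt_eq_zero_of_diagonal (hi : i₀ ≠ i₁) {P : Mat K k m}
    (hT : P ∈ Tkm0 K k m) (hP : evalAt (slicePt K o i₀ i₁) P = 0)
    (b : Fin m → Matrix (Fin k) (Fin k) L) (h₀ : ∀ p q, p ≠ q → b i₀ p q = 0) :
    evalAt b P = 0 := by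
  let c : Fin m → Mat K k m := fun i =>
    Matrix.of fun p q => if i = i₀ ∧ p ≠ q then 0 else MvPolynomial.X (i, p, q)
  let φ : MvPolynomial (Fin m × Fin k × Fin k) K →ₐ[K]
      FractionRing (MvPolynomial (Fin m × Fin k × Fin k) K) := IsScalarTower.toAlgHom _ _ _
  have hφ : Function.Injective φ := IsFractionRing.injective _ _
  have hc : evalAt c P = 0 := by
    have := evalAt_eq_zero_of_diagonal_of_ne_zero hT hP (fun i => (c i).map φ)
      (fun p q hpq => by simp [c, hpq])
      (fun q hq => by
        rw [Matrix.map_apply, map_ne_zero_iff φ hφ]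
        simp [c, hi.symm])
    rw [evalAt_map] at this
    ext1 p q
    apply hφ
    simpa using congrFun (congrFun this p) q
  have hb : b = fun i => (c i).map
      (MvPolynomial.aeval fun v : Fin m × Fin k × Fin k => b v.1 v.2.1 v.2.2) := by
    ext i p q
    by_cases h : i = i₀ ∧ p ≠ q
    · simp [c, h, h₀ p q h.2]
    · simp [c, h]
  rw [hb, evalAt_map, hc]
  ext p q
  simp

/-- An element of `T_km⁰` vanishing on the slice is zero. -/
theorem eq_zero_of_evalAt_slicePt_eq_zero (hi : i₀ ≠ i₁) {P : Mat K k m}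
    (hT : P ∈ Tkm0 K k m) (hP : evalAt (slicePt K o i₀ i₁) P = 0) : P = 0 := by
  let Ω := MvPolynomial (Fin m × Fin k × Fin k) K
  let L := AlgebraicClosure (FractionRing Ω)
  let φ : Ω →ₐ[K] L := IsScalarTower.toAlgHom _ _ _
  have hφ : Function.Injective φ := by
    have h := (algebraMap (FractionRing Ω) L).injective.comp (IsFractionRing.injective Ω _)
    rwa [← RingHom.coe_comp, ← IsScalarTower.algebraMap_eq] at h
  have : CharZero L := charZero_of_injective_algebraMap (algebraMap K L).injective
  obtain ⟨g, d, hg⟩ := Matrix.exists_mul_eq_mul_diagonal _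
    (separable_charpoly_genY (K := K) (k := k) i₀ (φ : Ω →+* L) hφ)
  have hd : g⁻¹.1 * (genY K k m i₀).map φ * g.1 = Matrix.diagonal d := by
    rw [mul_assoc]
    erw [hg]
    rw [← mul_assoc, Units.inv_mul, one_mul]
  have h0 := evalAt_eq_zero_of_diagonal hi hT hP (fun i => g⁻¹.1 * (genY K k m i).map φ * g.1)
    (fun p q hpq => by rw [hd, Matrix.diagonal_apply_ne _ hpq])
  have h1 := evalAt_conj_of_mem o.pos.ne' hT g 0 (fun i => g⁻¹.1 * (genY K k m i).map φ * g.1)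
    (fun i => (genY K k m i).map φ) (fun i => by
      simp only [Pi.zero_apply, map_zero, add_zero]
      rw [mul_assoc, mul_assoc, mul_assoc, Units.mul_inv, mul_one, ← mul_assoc, Units.mul_inv,
        one_mul])
  rw [h0, evalAt_map] at h1
  have hid : evalAt (genY K k m) P = P := by
    ext1 p q
    simp [evalAt_apply, genY]
  rw [hid] at h1
  ext1 p q
  apply hφ
  simpa using congrFun (congrFun h1 p) q

end Slice

section Algebraicity

variable {A E : Type} [Field A] [Field E] [Algebra A E]

theorem trace_mem_of_mem_adjoin {k m : ℕ} (Z : Fin m → Matrix (Fin k) (Fin k) E)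
    (htr : ∀ (l : ℕ) (w : Fin (l + 1) → Fin m),
      (List.ofFn fun j => Z (w j)).prod.trace ∈ (algebraMap A E).range)
    {M : Matrix (Fin k) (Fin k) E} (hM : M ∈ Algebra.adjoin A (Set.range Z)) :
    M.trace ∈ (algebraMap A E).range := by
  have hword : ∀ M ∈ Submonoid.closure (Set.range Z),
      ∃ (l : ℕ) (w : Fin l → Fin m), M = (List.ofFn fun j => Z (w j)).prod := by
    intro M hM
    induction hM using Submonoid.closure_induction_left with
    | one => exact ⟨0, Fin.elim0, by simp⟩
    | mul_left x hx y _ ih =>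
      obtain ⟨i, rfl⟩ := hx
      obtain ⟨l, w, rfl⟩ := ih
      exact ⟨l + 1, Fin.cons i w, by simp [List.ofFn_succ]⟩
  rw [← Subalgebra.mem_toSubmodule, Algebra.adjoin_eq_span] at hM
  induction hM using Submodule.span_induction with
  | mem x hx =>
    obtain ⟨l, w, rfl⟩ := hword x hx
    cases l with
    | zero => exact ⟨k, by simp⟩
    | succ l => exact htr l w
  | zero => exact ⟨0, by simp⟩
  | add x y _ _ hx hy => rw [Matrix.trace_add]; exact add_mem hx hy
  | smul a x _ hx =>
    rw [Matrix.trace_smul, Algebra.smul_def]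
    exact mul_mem ⟨a, rfl⟩ hx

open MvPolynomial in
theorem aeval_esymm_mem_of_psum [CharZero A] {k : ℕ} (μ : Fin k → E)
    (hμ : ∀ l : ℕ, ∑ p, μ p ^ l ∈ (algebraMap A E).range) (n : ℕ) :
    aeval μ (esymm (Fin k) A n) ∈ (algebraMap A E).range := by
  induction n using Nat.strong_induction_on with
  | _ n ih =>
    rcases Nat.eq_zero_or_pos n with rfl | hn
    · exact ⟨1, by simp⟩
    have h := congrArg (aeval μ) (mul_esymm_eq_sum (Fin k) A n)
    have hmem : (n : E) * aeval μ (esymm (Fin k) A n) ∈ (algebraMap A E).range := by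
      rw [map_mul, map_natCast] at h
      rw [h, map_mul, map_sum]
      refine mul_mem ⟨(-1) ^ (n + 1), by simp⟩ (sum_mem fun a ha => ?_)
      rw [map_mul, map_mul]
      refine mul_mem (mul_mem ⟨(-1) ^ a.1, by simp⟩ (ih _ (Finset.mem_filter.1 ha).2)) ?_
      simpa [psum] using hμ a.2
    obtain ⟨c, hc⟩ := hmem
    have hE : CharZero E := charZero_of_injective_algebraMap (algebraMap A E).injective
    have hn' : (n : E) ≠ 0 := by exact_mod_cast hn.ne'
    refine ⟨(n : A)⁻¹ * c, ?_⟩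
    rw [map_mul, map_inv₀, map_natCast, hc, inv_mul_cancel_left₀ hn']

open Polynomial in
theorem isAlgebraic_of_psum [CharZero A] {k : ℕ} (μ : Fin k → E)
    (hμ : ∀ l : ℕ, ∑ p, μ p ^ l ∈ (algebraMap A E).range) (p : Fin k) :
    IsAlgebraic A (μ p) := by
  have h := congrArg
    (Polynomial.map (MvPolynomial.aeval μ : MvPolynomial (Fin k) A →ₐ[A] E).toRingHom)
    (MvPolynomial.prod_C_add_X_eq_sum_esymm A (Fin k))
  have hmem : ∏ i, (X + C (μ i)) ∈ Polynomial.lifts (algebraMap A E) := by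
    have h' : ∏ i, (X + C (μ i)) = ∑ j ∈ Finset.range (k + 1),
        C (MvPolynomial.aeval μ (MvPolynomial.esymm (Fin k) A j)) * X ^ (k - j) := by
      simpa [Polynomial.map_prod, Polynomial.map_sum] using h
    rw [h']
    refine sum_mem fun j _ => mul_mem ?_ (pow_mem (X_mem_lifts _) _)
    obtain ⟨c, hc⟩ := aeval_esymm_mem_of_psum μ hμ j
    rw [← hc]
    exact C_mem_lifts _ _
  obtain ⟨q, hq⟩ := (mem_lifts _).1 hmem
  rw [← neg_neg (μ p)]
  refine IsAlgebraic.neg ⟨q, ?_, ?_⟩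
  · rintro rfl
    rw [Polynomial.map_zero] at hq
    exact (monic_prod_of_monic _ _ fun i _ => monic_X_add_C (μ i)).ne_zero hq.symm
  · rw [aeval_def, ← eval_map, hq, eval_prod]
    exact Finset.prod_eq_zero (Finset.mem_univ p) (by simp)

/-- If the field `A` contains all traces of words in the matrices `Z i` and is algebraically
closed in `E`, one of the matrices is diagonal with simple spectrum and another one has a
normalized row, then all entries of the `Z i` belong to `A`. -/
theorem entries_mem_of_traces [CharZero A]
    (hA : ∀ x : E, IsAlgebraic A x → x ∈ (algebraMap A E).range)
    {k m : ℕ} (Z : Fin m → Matrix (Fin k) (Fin k) E)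
    (htr : ∀ (l : ℕ) (w : Fin (l + 1) → Fin m),
      (List.ofFn fun j => Z (w j)).prod.trace ∈ (algebraMap A E).range)
    (o : Fin k) (i₀ i₁ : Fin m) (μ : Fin k → E) (hμ : Function.Injective μ)
    (h₀ : Z i₀ = Matrix.diagonal μ) (h₁ : ∀ q, q ≠ o → Z i₁ o q = 1)
    (h₂ : ∀ q, q ≠ o → Z i₁ q o ≠ 0) (i : Fin m) (p q : Fin k) :
    Z i p q ∈ (algebraMap A E).range := by
  set W := Algebra.adjoin A (Set.range Z) with hW
  have hZ (i : Fin m) : Z i ∈ W := Algebra.subset_adjoin ⟨i, rfl⟩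
  have htrace {M : Matrix (Fin k) (Fin k) E} (hM : M ∈ W) := trace_mem_of_mem_adjoin Z htr hM
  have hμA (p : Fin k) : μ p ∈ (algebraMap A E).range := by
    refine hA _ (isAlgebraic_of_psum μ (fun l => ?_) p)
    have := htrace (pow_mem (hZ i₀) l)
    simpa [h₀, Matrix.diagonal_pow, Matrix.trace_diagonal] using this
  choose ν hν using hμA
  have hidem (p : Fin k) : Matrix.single p p (1 : E) ∈ W := by
    have h : Matrix.single p p (1 : E) =
        Polynomial.aeval (Z i₀) (Lagrange.basis Finset.univ ν p) := by
      have hν' : Function.Injective ν := fun a b hab => hμ (by rw [← hν, ← hν, hab])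
      have hval (q : Fin k) : Polynomial.aeval (μ q) (Lagrange.basis Finset.univ ν p) =
          if p = q then (1 : E) else 0 := by
        rw [← hν, Polynomial.aeval_algebraMap_apply, Polynomial.coe_aeval_eq_eval]
        split_ifs with hpq
        · rw [← hpq, Lagrange.eval_basis_self hν'.injOn (Finset.mem_univ _), map_one]
        · rw [Lagrange.eval_basis_of_ne hpq (Finset.mem_univ _), map_zero]
      rw [h₀, ← Matrix.diagonalAlgHom_apply (R := A), Polynomial.aeval_algHom_apply,
        Matrix.diagonalAlgHom_apply]
      have hpi : Polynomial.aeval μ (Lagrange.basis Finset.univ ν p) =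
          Pi.single (M := fun _ => E) p 1 := by
        ext q
        rw [Polynomial.aeval_pi_apply₂, hval, Pi.single_apply]
        simp [eq_comm]
      rw [hpi, Matrix.diagonal_single]
    rw [h]
    exact Algebra.adjoin_mono (Set.singleton_subset_iff.2 (Set.mem_range_self i₀))
      (Polynomial.aeval_mem_adjoin_singleton A _)
  have hrow (j : Fin k) : Matrix.single o j (1 : E) ∈ W := by
    by_cases hj : j = o
    · rw [hj]; exact hidem o
    · have := mul_mem (mul_mem (hidem o) (hZ i₁)) (hidem j)
      rwa [Matrix.single_mul_mul_single, h₁ j hj, one_mul, one_mul] at this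
  have hcol (j : Fin k) : Matrix.single j o (1 : E) ∈ W := by
    by_cases hj : j = o
    · rw [hj]; exact hidem o
    · obtain ⟨c, hc⟩ : Z i₁ j o ∈ (algebraMap A E).range := by
        have := htrace (mul_mem (hrow j) (hZ i₁))
        rwa [Matrix.trace_single_mul, one_smul] at this
      have hc0 : c ≠ 0 := by
        rintro rfl
        exact h₂ j hj (by rw [← hc, map_zero])
      have := W.smul_mem (mul_mem (mul_mem (hidem j) (hZ i₁)) (hidem o)) c⁻¹
      rwa [Matrix.single_mul_mul_single, one_mul, mul_one, ← hc, Matrix.smul_single,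
        Algebra.smul_def, ← map_mul, inv_mul_cancel₀ hc0, map_one] at this
  have := htrace (mul_mem (mul_mem (hcol q) (hrow p)) (hZ i))
  rwa [Matrix.single_mul_single_same, mul_one, Matrix.trace_single_mul, one_smul] at this

end Algebraicity

section TraceIndependence

variable {K : Type} [Field K] {k m : ℕ}

/-- The trace of a word in the generic traceless matrices. -/
def wordTrace (K : Type) [Field K] (k m : ℕ) (x : Σ l : ℕ, Fin (l + 1) → Fin m) :
    MvPolynomial (Fin m × Fin k × Fin k) K :=
  Matrix.trace ((List.ofFn fun j => genZ K k m (x.2 j)).prod)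

theorem tracelessPart_apply {R : Type} [CommRing R] [Algebra K R]
    (a : Matrix (Fin k) (Fin k) R) (p q : Fin k) :
    tracelessPart K a p q = a p q - if p = q then (k : K)⁻¹ • a.trace else 0 := by
  simp only [tracelessPart, Matrix.sub_apply, Matrix.smul_apply, Matrix.algebraMap_matrix_apply]
  split_ifs <;> simp

variable {o : Fin k} {i₀ i₁ : Fin m}

theorem slicePt_of_isSliceVar {i : Fin m} {p q : Fin k} (h : IsSliceVar o i₀ i₁ (i, p, q)) :
    slicePt K o i₀ i₁ i p q = MvPolynomial.X ⟨(i, p, q), h⟩ := by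
  simp only [slicePt, Matrix.of_apply, dif_pos h]

theorem slicePt_self (i : Fin m) : slicePt K o i₀ i₁ i o o = 0 := by
  simp [slicePt]

theorem isAlgebraic_of_word_trace_mem [CharZero K] (hi : i₀ ≠ i₁)
    {E : Type} [Field E] [Algebra K E]
    [Algebra (MvPolynomial (SliceVar o i₀ i₁) K) E]
    [IsScalarTower K (MvPolynomial (SliceVar o i₀ i₁) K) E]
    [IsFractionRing (MvPolynomial (SliceVar o i₀ i₁) K) E]
    (X : Fin m → Matrix (Fin k) (Fin k) E)
    (hX : ∀ i, X i = (slicePt K o i₀ i₁ i).map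
      (algebraMap (MvPolynomial (SliceVar o i₀ i₁) K) E))
    (F : IntermediateField K E)
    (hF : ∀ (l : ℕ) (w : Fin (l + 1) → Fin m),
      (List.ofFn fun j => tracelessPart K (X (w j))).prod.trace ∈ F) :
    Algebra.IsAlgebraic F E := by
  let A := algebraicClosure F E
  have hinj : Function.Injective (algebraMap (MvPolynomial (SliceVar o i₀ i₁) K) E) :=
    IsFractionRing.injective _ _
  have hFA {x : E} (hx : x ∈ F) : x ∈ A := A.algebraMap_mem ⟨x, hx⟩
  have hA {x : E} : x ∈ (algebraMap A E).range ↔ x ∈ A :=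
    ⟨by rintro ⟨y, rfl⟩; exact y.2, fun h => ⟨⟨x, h⟩, rfl⟩⟩
  have hvar (v : SliceVar o i₀ i₁) : X v.1.1 v.1.2.1 v.1.2.2 =
      algebraMap (MvPolynomial (SliceVar o i₀ i₁) K) E (MvPolynomial.X v) := by
    rw [hX, Matrix.map_apply, slicePt_of_isSliceVar v.2]
  have hself (i : Fin m) : X i o o = 0 := by rw [hX, Matrix.map_apply, slicePt_self, map_zero]
  have : CharZero A := charZero_of_injective_algebraMap (algebraMap K A).injective
  have hent := entries_mem_of_traces (A := A) (E := E) (fun x hx => by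
      have h : IsAlgebraic F x := hx.restrictScalars F
      exact hA.2 (mem_algebraicClosure_iff.2 h))
    (fun i => tracelessPart K (X i)) (fun l w => hA.2 (hFA (hF l w))) o i₀ i₁
    (fun p => tracelessPart K (X i₀) p p)
    (by
      intro p q hpq
      simp only [tracelessPart_apply, if_true, sub_left_inj] at hpq
      rw [hX, Matrix.map_apply, Matrix.map_apply] at hpq
      have h := hinj hpq
      by_cases hp : p = o <;> by_cases hq : q = o
      · rw [hp, hq]
      · exfalso
        rw [hp, slicePt_self, slicePt_of_isSliceVar ⟨by simpa using hq, by simp, by simp [hi]⟩] at h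
        exact MvPolynomial.X_ne_zero _ h.symm
      · exfalso
        rw [hq, slicePt_self, slicePt_of_isSliceVar ⟨by simpa using hp, by simp, by simp [hi]⟩] at h
        exact MvPolynomial.X_ne_zero _ h
      · rw [slicePt_of_isSliceVar ⟨by simpa using hp, by simp, by simp [hi]⟩,
          slicePt_of_isSliceVar ⟨by simpa using hq, by simp, by simp [hi]⟩] at h
        simpa using MvPolynomial.X_injective h)
    (by
      ext p q
      rw [Matrix.diagonal_apply]
      split_ifs with h
      · rw [h]
      · rw [tracelessPart_apply, hX, Matrix.map_apply]
        simp [slicePt, h, hi])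
    (by
      intro q hq
      rw [tracelessPart_apply, hX, Matrix.map_apply]
      simp [slicePt, hq, hq.symm])
    (by
      intro q hq
      have hv : IsSliceVar o i₀ i₁ (i₁, q, o) :=
        ⟨by simpa using hq, fun h => absurd h hi.symm, fun _ => hq⟩
      rw [tracelessPart_apply, if_neg hq, sub_zero, hvar ⟨_, hv⟩, map_ne_zero_iff _ hinj]
      exact MvPolynomial.X_ne_zero _)
  have hXA (i : Fin m) (p q : Fin k) : X i p q ∈ A := by
    have h1 := hA.1 (hent i p q)
    by_cases hpq : p = q
    · have h2 := A.sub_mem h1 (hA.1 (hent i o o))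
      simpa [tracelessPart_apply, hpq, hself] using h2
    · simpa [tracelessPart_apply, hpq] using h1
  have hpoly (f : MvPolynomial (SliceVar o i₀ i₁) K) :
      algebraMap (MvPolynomial (SliceVar o i₀ i₁) K) E f ∈ A := by
    induction f using MvPolynomial.induction_on with
    | C a =>
      rw [← MvPolynomial.algebraMap_eq, ← IsScalarTower.algebraMap_apply]
      exact hFA (F.algebraMap_mem a)
    | add f g hf hg => rw [map_add]; exact add_mem hf hg
    | mul_X f v hf => rw [map_mul, ← hvar]; exact mul_mem hf (hXA _ _ _)
  refine ⟨fun x => ?_⟩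
  obtain ⟨a, b, _, rfl⟩ := IsFractionRing.div_surjective (A := MvPolynomial (SliceVar o i₀ i₁) K) x
  exact mem_algebraicClosure_iff.1 (A.div_mem (hpoly a) (hpoly b))

open scoped IntermediateField.algebraAdjoinAdjoin in
theorem exists_algebraicIndependent_wordTrace [CharZero K] (o : Fin k) (hi : i₀ ≠ i₁) :
    ∃ x : SliceVar o i₀ i₁ → Σ l : ℕ, Fin (l + 1) → Fin m,
      AlgebraicIndependent K fun v => wordTrace K k m (x v) := by
  let B := MvPolynomial (SliceVar o i₀ i₁) K
  let E := FractionRing B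
  let X : Fin m → Matrix (Fin k) (Fin k) E := fun i => (slicePt K o i₀ i₁ i).map (algebraMap B E)
  let τ : MvPolynomial (Fin m × Fin k × Fin k) K →ₐ[K] E :=
    MvPolynomial.aeval fun v => X v.1 v.2.1 v.2.2
  have hτ (x : Σ l : ℕ, Fin (l + 1) → Fin m) : τ (wordTrace K k m x) =
      (List.ofFn fun j => tracelessPart K (X (x.2 j))).prod.trace := by
    rw [wordTrace, aeval_trace, evalAt_word]
  set s : Set E := Set.range fun x => τ (wordTrace K k m x) with hs
  have h1 : Algebra.IsAlgebraic (IntermediateField.adjoin K s) E :=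
    isAlgebraic_of_word_trace_mem hi X (fun _ => rfl) _ fun l w => by
      rw [← hτ ⟨l, w⟩]
      exact IntermediateField.subset_adjoin K s ⟨_, rfl⟩
  have h2 : Algebra.IsAlgebraic (Algebra.adjoin K s) E :=
    (IsFractionRing.comap_isAlgebraic_iff (A := Algebra.adjoin K s)
      (K := IntermediateField.adjoin K s) (C := E)).2 h1
  obtain ⟨t, hts, ht⟩ := exists_isTranscendenceBasis_subset (R := K) s
  have hB : Algebra.IsAlgebraic B E := IsLocalization.isAlgebraic E (nonZeroDivisors B)
  have hE : IsTranscendenceBasis K (algebraMap B E ∘ (MvPolynomial.X : SliceVar o i₀ i₁ → B)) :=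
    (IsTranscendenceBasis.mvPolynomial (SliceVar o i₀ i₁) K).algebraMap_comp
  obtain ⟨e⟩ := Cardinal.eq.1 (hE.cardinalMk_eq ht)
  choose x hx using fun y : t => hts y.2
  refine ⟨fun v => x (e v), AlgebraicIndependent.of_comp τ ?_⟩
  have : τ ∘ (fun v => wordTrace K k m (x (e v))) = fun v => ((e v : t) : E) :=
    funext fun v => hx (e v)
  rw [this]
  exact ht.1.comp e e.injective

end TraceIndependence

theorem card_sliceVar {k m : ℕ} (o : Fin k) {i₀ i₁ : Fin m} (hi : i₀ ≠ i₁) :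
    (Fintype.card (SliceVar o i₀ i₁) : ℝ) = ((k : ℝ) ^ 2 - 1) * ((m : ℝ) - 1) := by
  have hk : 1 ≤ k := o.pos
  have c0 : (Finset.univ.filter fun x : Fin k × Fin k => x ≠ (o, o) ∧ x.1 = x.2).card = k - 1 := by
    rw [show (Finset.univ.filter fun x : Fin k × Fin k => x ≠ (o, o) ∧ x.1 = x.2) =
      (Finset.univ.erase o).image fun p => (p, p) by ext ⟨p, q⟩; simp; grind]
    rw [Finset.card_image_of_injective _ fun a b h => (Prod.mk.inj h).1]
    simp
  have c1 : (Finset.univ.filter fun x : Fin k × Fin k => x ≠ (o, o) ∧ x.1 ≠ o).card =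
      (k - 1) * k := by
    rw [show (Finset.univ.filter fun x : Fin k × Fin k => x ≠ (o, o) ∧ x.1 ≠ o) =
      (Finset.univ.erase o) ×ˢ Finset.univ by ext ⟨p, q⟩; simp; grind]
    simp
  have c2 : (Finset.univ.filter fun x : Fin k × Fin k => x ≠ (o, o)).card = k * k - 1 := by
    rw [Finset.filter_ne', Finset.card_erase_of_mem (Finset.mem_univ _)]
    simp
  have hsum : Fintype.card (SliceVar o i₀ i₁) =
      ∑ i, (Finset.univ.filter fun x : Fin k × Fin k => IsSliceVar o i₀ i₁ (i, x)).card := by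
    rw [Fintype.card_subtype]
    simp only [Finset.card_filter, Fintype.sum_prod_type]
  have hterm (i : Fin m) :
      ((Finset.univ.filter fun x : Fin k × Fin k => IsSliceVar o i₀ i₁ (i, x)).card : ℝ) =
      ((k : ℝ) ^ 2 - 1) + (if i = i₀ then (k : ℝ) - k ^ 2 else 0) +
        (if i = i₁ then 1 - (k : ℝ) else 0) := by
    by_cases h0 : i = i₀
    · subst h0
      simp only [IsSliceVar, forall_const, hi, false_imp_iff, and_true, c0, if_true, if_false]
      push_cast [hk]
      ring
    · by_cases h1 : i = i₁
      · subst h1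
        simp only [IsSliceVar, forall_const, h0, false_imp_iff, true_and, c1, if_true, if_false]
        push_cast [hk]
        ring
      · simp only [IsSliceVar, h0, h1, false_imp_iff, and_true, c2, if_false]
        push_cast [Nat.mul_pos hk hk]
        ring
  rw [hsum]
  push_cast
  simp only [hterm, Finset.sum_add_distrib, Finset.sum_ite_eq', Finset.mem_univ, if_true,
    Finset.sum_const, Finset.card_univ, Fintype.card_fin, nsmul_eq_mul]
  ring

section Counting

variable {K : Type} [Field K]

theorem finrank_restrictDegree (σ : Type) [Fintype σ] (N : ℕ) :
    Module.finrank K (MvPolynomial.restrictDegree σ K N) = (N + 1) ^ Fintype.card σ := by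
  let e : {u : σ →₀ ℕ | ∀ i, u i ≤ N} ≃ (σ → Fin (N + 1)) :=
    { toFun := fun u i => ⟨u.1 i, Nat.lt_succ_of_le (u.2 i)⟩
      invFun := fun g => ⟨Finsupp.equivFunOnFinite.symm fun i => (g i : ℕ),
        fun i => Nat.le_of_lt_succ (g i).2⟩
      left_inv := fun u => by ext; simp
      right_inv := fun g => by ext; simp }
  rw [MvPolynomial.restrictDegree, Module.finrank_eq_nat_card_basis
    (MvPolynomial.basisRestrictSupport K {u : σ →₀ ℕ | ∀ i, u i ≤ N}), Nat.card_congr e,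
    Nat.card_fun, Nat.card_fin, Nat.card_eq_fintype_card]

theorem totalDegree_le_of_mem_restrictDegree {σ : Type} [Fintype σ] {N : ℕ}
    {p : MvPolynomial σ K} (hp : p ∈ MvPolynomial.restrictDegree σ K N) :
    p.totalDegree ≤ Fintype.card σ * N := by
  refine Finset.sup_le fun u hu => ?_
  rw [Finsupp.sum_fintype _ _ fun _ => rfl]
  refine (Finset.sum_le_card_nsmul _ _ N fun i _ => ?_).trans (by simp)
  exact (MvPolynomial.mem_restrictDegree _ _ _).1 hp u hu i

theorem totalDegree_aeval_le {σ τ : Type} {D : ℕ} {f : σ → MvPolynomial τ K}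
    (hf : ∀ v, (f v).totalDegree ≤ D) (p : MvPolynomial σ K) :
    (MvPolynomial.aeval f p).totalDegree ≤ D * p.totalDegree := by
  rw [MvPolynomial.aeval_def, MvPolynomial.eval₂_eq]
  refine MvPolynomial.totalDegree_finsetSum_le fun u hu => ?_
  refine (MvPolynomial.totalDegree_mul _ _).trans ?_
  rw [MvPolynomial.algebraMap_eq, MvPolynomial.totalDegree_C, zero_add]
  refine (MvPolynomial.totalDegree_finsetProd _ _).trans ?_
  calc ∑ i ∈ u.support, (f i ^ u i).totalDegree
      ≤ ∑ i ∈ u.support, D * u i := Finset.sum_le_sum fun i _ =>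
        (MvPolynomial.totalDegree_pow _ _).trans (by
          rw [mul_comm]; exact Nat.mul_le_mul_right _ (hf i))
    _ = D * u.sum fun _ e => e := by rw [← Finset.mul_sum]; rfl
    _ ≤ D * p.totalDegree := Nat.mul_le_mul_left _ (MvPolynomial.le_totalDegree hu)

variable {k m : ℕ}

instance finite_degLE (n : ℕ) : Module.Finite K (degLE K k m n) := by
  let φ : degLE K k m n →ₗ[K]
      (Fin k → Fin k → MvPolynomial.restrictTotalDegree (Fin m × Fin k × Fin k) K n) :=
    { toFun := fun a p q => ⟨a.1 p q, (MvPolynomial.mem_restrictTotalDegree _ _ _).2 (a.2 p q)⟩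
      map_add' := fun _ _ => rfl
      map_smul' := fun _ _ => rfl }
  refine Module.Finite.of_injective φ fun a b h => ?_
  ext1
  ext1 p q
  exact congrArg Subtype.val (congrFun (congrFun h p) q)

theorem growth_mono {A B : Subalgebra K (Mat K k m)} (h : A ≤ B) (n : ℕ) :
    growth K k m A n ≤ growth K k m B n := by
  have : Module.Finite K ↥(Subalgebra.toSubmodule B ⊓ degLE K k m n) :=
    Submodule.finiteDimensional_inf_right _ _
  exact Submodule.finrank_mono (inf_le_inf_right _ h)

variable {o : Fin k} {i₀ i₁ : Fin m}

theorem totalDegree_slicePt_le (i : Fin m) (p q : Fin k) :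
    (slicePt K o i₀ i₁ i p q).totalDegree ≤ 1 := by
  rw [slicePt, Matrix.of_apply]
  split_ifs <;> simp

theorem growth_Tkm0_le [CharZero K] (o : Fin k) (hi : i₀ ≠ i₁) (n : ℕ) :
    growth K k m (Tkm0 K k m) n ≤ k ^ 2 * (n + 1) ^ Fintype.card (SliceVar o i₀ i₁) := by
  have hdeg (a : Mat K k m) (ha : a ∈ degLE K k m n) (p q : Fin k) :
      evalAt (slicePt K o i₀ i₁) a p q ∈ MvPolynomial.restrictDegree (SliceVar o i₀ i₁) K n := by
    refine MvPolynomial.restrictTotalDegree_le_restrictDegree _ _ _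
      ((MvPolynomial.mem_restrictTotalDegree _ _ _).2 ?_)
    rw [evalAt_apply]
    refine (totalDegree_aeval_le (fun v => totalDegree_slicePt_le _ _ _) _).trans ?_
    rw [one_mul]
    exact ha p q
  let φ : ↥(Subalgebra.toSubmodule (Tkm0 K k m) ⊓ degLE K k m n) →ₗ[K]
      (Fin k → Fin k → MvPolynomial.restrictDegree (SliceVar o i₀ i₁) K n) :=
    { toFun := fun a p q => ⟨evalAt (slicePt K o i₀ i₁) a.1 p q, hdeg _ a.2.2 p q⟩
      map_add' := fun a b => by
        ext p q : 3
        simp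
      map_smul' := fun c a => by
        ext p q : 3
        simp }
  have hφ : Function.Injective φ := by
    rw [injective_iff_map_eq_zero]
    intro a ha
    refine Subtype.ext (eq_zero_of_evalAt_slicePt_eq_zero (o := o) hi a.2.1 ?_)
    ext1 p q
    exact congrArg Subtype.val (congrFun (congrFun ha p) q)
  refine (LinearMap.finrank_le_finrank_of_injective hφ).trans (le_of_eq ?_)
  simp only [Module.finrank_pi_fintype, finrank_restrictDegree]
  simp [sq, mul_assoc]

theorem scalarOf_wordTrace_mem (x : Σ l : ℕ, Fin (l + 1) → Fin m) :
    scalarOf K k m (wordTrace K k m x) ∈ Ckm0 K k m :=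
  Algebra.subset_adjoin ⟨x.1, x.2, rfl⟩

theorem exists_le_growth_Ckm0 [CharZero K] (o : Fin k) (hi : i₀ ≠ i₁) :
    ∃ D : ℕ, 0 < D ∧ ∀ N : ℕ,
      (N + 1) ^ Fintype.card (SliceVar o i₀ i₁) ≤ growth K k m (Ckm0 K k m) (D * N) := by
  obtain ⟨x, hx⟩ := exists_algebraicIndependent_wordTrace (K := K) o hi
  let f := fun v => wordTrace K k m (x v)
  let D := ∑ v, (f v).totalDegree
  have hD (v) : (f v).totalDegree ≤ D :=
    Finset.single_le_sum (f := fun v => (f v).totalDegree) (fun _ _ => Nat.zero_le _)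
      (Finset.mem_univ v)
  refine ⟨D * Fintype.card (SliceVar o i₀ i₁) + 1, Nat.succ_pos _, fun N => ?_⟩
  set n := (D * Fintype.card (SliceVar o i₀ i₁) + 1) * N with hn
  let ψ : MvPolynomial (SliceVar o i₀ i₁) K →ₐ[K] Mat K k m :=
    (IsScalarTower.toAlgHom K (MvPolynomial (Fin m × Fin k × Fin k) K) (Mat K k m)).comp
      (MvPolynomial.aeval f)
  have hψ (p) : ψ p = scalarOf K k m (MvPolynomial.aeval f p) := rfl
  have : Nonempty (Fin k) := ⟨o⟩
  have hinj : Function.Injective ψ :=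
    (FaithfulSMul.algebraMap_injective (MvPolynomial (Fin m × Fin k × Fin k) K)
      (Mat K k m)).comp hx
  have hmem (p) : ψ p ∈ Ckm0 K k m := by
    induction p using MvPolynomial.induction_on with
    | C a =>
      rw [← MvPolynomial.algebraMap_eq, AlgHom.commutes]
      exact (Ckm0 K k m).algebraMap_mem a
    | add f g hf hg => rw [map_add]; exact add_mem hf hg
    | mul_X g v hg =>
      rw [map_mul]
      refine mul_mem hg ?_
      rw [hψ, MvPolynomial.aeval_X]
      exact scalarOf_wordTrace_mem _
  have hdeg (p) (hp : p ∈ MvPolynomial.restrictDegree (SliceVar o i₀ i₁) K N) :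
      ψ p ∈ degLE K k m n := by
    intro i j
    rw [hψ, scalarOf, Matrix.algebraMap_matrix_apply]
    split_ifs
    · refine (totalDegree_aeval_le hD p).trans
        ((Nat.mul_le_mul_left _ (totalDegree_le_of_mem_restrictDegree hp)).trans ?_)
      rw [← mul_assoc, hn]
      exact Nat.mul_le_mul_right _ (Nat.le_succ _)
    · simp
  have : Module.Finite K ↥(Subalgebra.toSubmodule (Ckm0 K k m) ⊓ degLE K k m n) :=
    Submodule.finiteDimensional_inf_right _ _
  rw [← finrank_restrictDegree (K := K)]
  exact LinearMap.finrank_le_finrank_of_injective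
    (f := (ψ.toLinearMap.domRestrict _).codRestrict _ fun p => ⟨hmem p.1, hdeg p.1 p.2⟩)
    fun p q h => Subtype.ext (hinj (congrArg Subtype.val h))

end Counting

section Asymptotics

open Filter Topology

theorem limsup_log_div_log_eq {g : ℕ → ℕ} {d c D : ℕ} (hc : 0 < c) (hD : 0 < D)
    (hmono : Monotone g) (hle : ∀ n, g n ≤ c * (n + 1) ^ d)
    (hge : ∀ N, (N + 1) ^ d ≤ g (D * N)) :
    atTop.limsup (fun n : ℕ => Real.log (g n) / Real.log n) = d := by
  have hlog : Tendsto (fun n : ℕ => Real.log n) atTop atTop :=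
    Real.tendsto_log_atTop.comp tendsto_natCast_atTop_atTop
  have hlim (a : ℝ) : Tendsto (fun n : ℕ => a / Real.log n + d) atTop (𝓝 d) := by
    simpa using (tendsto_const_nhds.div_atTop hlog).add_const (d : ℝ)
  have hlow (n : ℕ) : (n : ℝ) ^ d ≤ (D : ℝ) ^ d * g n := by
    have h1 : n ≤ D * (n / D + 1) := (Nat.lt_mul_div_succ n hD).le
    have h2 : n ^ d ≤ D ^ d * g n := by
      refine (Nat.pow_le_pow_left h1 d).trans ?_
      rw [mul_pow]
      exact Nat.mul_le_mul_left _ ((hge _).trans (hmono (Nat.mul_div_le n D)))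
    exact_mod_cast h2
  have hup (n : ℕ) (hn : 1 ≤ n) : (g n : ℝ) ≤ c * 2 ^ d * (n : ℝ) ^ d := by
    have h1 : g n ≤ c * 2 ^ d * n ^ d := by
      refine (hle n).trans ?_
      rw [mul_assoc, ← mul_pow]
      exact Nat.mul_le_mul_left _ (Nat.pow_le_pow_left (by omega) d)
    exact_mod_cast h1
  refine (tendsto_of_tendsto_of_tendsto_of_le_of_le' (hlim (-Real.log ((D : ℝ) ^ d)))
    (hlim (Real.log (c * 2 ^ d))) ?_ ?_).limsup_eq
  all_goals
    filter_upwards [eventually_ge_atTop 2] with n hn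
    have hn0 : (0 : ℝ) < n := by exact_mod_cast (by omega : 0 < n)
    have hln : 0 < Real.log n := Real.log_pos (by exact_mod_cast hn)
    have hD0 : (0 : ℝ) < (D : ℝ) ^ d := by positivity
    have hg0 : (0 : ℝ) < g n := by
      have := (pow_pos hn0 d).trans_le (hlow n)
      exact (pos_iff_pos_of_mul_pos this).1 hD0
    rw [div_add' _ _ _ hln.ne', div_le_div_iff_of_pos_right hln]
  · have h := Real.log_le_log (pow_pos hn0 d) (hlow n)
    rw [Real.log_mul hD0.ne' hg0.ne', Real.log_pow n d] at h
    linarith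
  · have h := Real.log_le_log hg0 (hup n (by omega))
    have hc0 : (0 : ℝ) < c * 2 ^ d := by positivity
    rw [Real.log_mul hc0.ne' (pow_pos hn0 d).ne', Real.log_pow n d] at h
    linarith

end Asymptotics

theorem growth_monotone {K : Type} [Field K] {k m : ℕ} (A : Subalgebra K (Mat K k m)) :
    Monotone (growth K k m A) := by
  intro a b hab
  have : Module.Finite K ↥(Subalgebra.toSubmodule A ⊓ degLE K k m b) :=
    Submodule.finiteDimensional_inf_right _ _
  exact Submodule.finrank_mono (inf_le_inf_left _ fun x hx p q => (hx p q).trans hab)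

/-- For `k, m ≥ 2`, `GKdim(T_km⁰) = GKdim(C_km⁰) = (k²−1)(m−1)`. -/
theorem stmt8 (K : Type) [Field K] [CharZero K] (k m : ℕ) (hk : 2 ≤ k) (hm : 2 ≤ m) :
    Filter.atTop.limsup
        (fun n : ℕ => Real.log (growth K k m (Tkm0 K k m) n) / Real.log n)
      = ((k : ℝ) ^ 2 - 1) * ((m : ℝ) - 1) ∧
    Filter.atTop.limsup
        (fun n : ℕ => Real.log (growth K k m (Ckm0 K k m) n) / Real.log n)
      = ((k : ℝ) ^ 2 - 1) * ((m : ℝ) - 1) := by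
  let o : Fin k := ⟨0, by omega⟩
  let i₀ : Fin m := ⟨0, by omega⟩
  let i₁ : Fin m := ⟨1, by omega⟩
  have hi : i₀ ≠ i₁ := by simp [i₀, i₁]
  obtain ⟨D, hD, hge⟩ := exists_le_growth_Ckm0 (K := K) o hi
  have hCT (n : ℕ) : growth K k m (Ckm0 K k m) n ≤ growth K k m (Tkm0 K k m) n :=
    growth_mono le_sup_right n
  have hle := growth_Tkm0_le (K := K) o hi
  have hc : 0 < k ^ 2 := by positivity
  rw [← card_sliceVar o hi]
  exact ⟨limsup_log_div_log_eq hc hD (growth_monotone _) hle fun N => (hge N).trans (hCT _),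
    limsup_log_div_log_eq hc hD (growth_monotone _) (fun n => (hCT n).trans (hle n)) hge⟩
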